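/- arXiv:1809.08190 — 2 statements merged into one kernel-verified Lean document; each statement's English description precedes it below -/
import Mathlib

section
/- Let n be a positive integer and let J ⊆ Fin n with J nonempty and J ≠ Fin n. Let η : (Fin n → ℝ) → (Fin n → ℝ) and θ* : (Fin n → ℝ) → (Fin n → ℝ) be maps such that: (i) θ* is differentiable at a point ρ and η is differentiable at θ*(ρ); (ii) for all ρ' and all i ∉ J, θ*(ρ')_i = ρ'_i; (iii) for all ρ' and all j ∈ J, η(θ*(ρ'))_j = ρ'_j. Write, for indices i, j, ∂θ*_i/∂ρ_j for the i-th component of the Fréchet derivative of θ* at ρ applied to the standard basis vector e_j, and ∂η_j/∂θ_k for the j-th component of the Fréchet derivative of η at θ*(ρ) applied to e_k. Assume the square matrix A = (∂η_j/∂θ_k)_{j∈J, k∈J} is invertible. Then: (1) the matrix B = (∂θ*_j/∂ρ_k)_{j∈J, k∈J} equals A⁻¹; (2) the matrix C = (∂θ*_j/∂ρ_i)_{j∈J, i∉J} equals A⁻¹ · (−D) where D = (∂η_j/∂θ_i)_{j∈J, i∉J}; (3) ∂θ*_i/∂ρ_j = 0 for all i ∉ J, j ∈ J; (4) ∂θ*_i/∂ρ_j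 = δ_{ij} (Kronecker delta) for all i ∉ J, j ∉ J. -/
/-- If the `i`-th component of `f` is the `i`-th coordinate, then so is that of its derivative. -/
theorem HasFDerivAt.apply_eq_of_forall_apply_eq {ι : Type*} [Fintype ι]
    {f : (ι → ℝ) → (ι → ℝ)} {f' : (ι → ℝ) →L[ℝ] (ι → ℝ)} {x : ι → ℝ}
    (hf : HasFDerivAt f f' x) {i : ι} (h : ∀ y, f y i = y i) (v : ι → ℝ) : f' v i = v i := by
  have h₁ : HasFDerivAt (fun y : ι → ℝ => y i) ((ContinuousLinearMap.proj i).comp f') x := by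
    simpa only [h] using hasFDerivAt_pi'.1 hf i
  exact DFunLike.congr_fun (h₁.unique (hasFDerivAt_apply i x)) v

/-- The components of `L v`, with the sum over the coordinates of `v` split along `J`. -/
theorem ContinuousLinearMap.pi_apply_eq_sum_subtype_add_sum_subtype {ι κ : Type*} [Fintype ι]
    [DecidableEq ι] (J : Finset ι) (L : (ι → ℝ) →L[ℝ] (κ → ℝ)) (v : ι → ℝ) (j : κ) :
    L v j = ∑ k : {k // k ∈ J}, L (Pi.single (k : ι) 1) j * v k +
      ∑ i : {i // i ∉ J}, L (Pi.single (i : ι) 1) j * v i := by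
  have hsum : L v j = ∑ k, L (Pi.single k 1) j * v k := by
    conv_lhs => rw [pi_eq_sum_univ' v]
    simp [mul_comm]
  rw [hsum, ← Fintype.sum_subtype_add_sum_subtype (· ∈ J)]
  congr!

/-- The block-Jacobian theorem for the mixed-coordinate conversion map `θ*`:
`∂θ*_J/∂ρ_J = (∂η_J/∂θ^J)⁻¹`, `∂θ*_J/∂ρ_{J̄} = (∂η_J/∂θ^J)⁻¹ · (−∂η_J/∂θ^{J̄})`,
`∂θ*_{J̄}/∂ρ_J = 0`, and `∂θ*_{J̄}/∂ρ_{J̄} = I`. -/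
theorem theta_star_block_jacobian
    (n : ℕ) (hn : 0 < n) (J : Finset (Fin n))
    (hJne : J.Nonempty) (hJtop : J ≠ Finset.univ)
    (η θs : (Fin n → ℝ) → (Fin n → ℝ)) (ρ : Fin n → ℝ)
    (hθs : DifferentiableAt ℝ θs ρ)
    (hη : DifferentiableAt ℝ η (θs ρ))
    (hout : ∀ ρ' : Fin n → ℝ, ∀ i ∉ J, θs ρ' i = ρ' i)
    (hin : ∀ ρ' : Fin n → ℝ, ∀ j ∈ J, η (θs ρ') j = ρ' j)
    (A B : Matrix {j // j ∈ J} {j // j ∈ J} ℝ)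
    (C D : Matrix {j // j ∈ J} {i // i ∉ J} ℝ)
    (hA : ∀ j k : {j // j ∈ J}, A j k = fderiv ℝ η (θs ρ) (Pi.single (k : Fin n) 1) (j : Fin n))
    (hB : ∀ j k : {j // j ∈ J}, B j k = fderiv ℝ θs ρ (Pi.single (k : Fin n) 1) (j : Fin n))
    (hC : ∀ (j : {j // j ∈ J}) (i : {i // i ∉ J}),
      C j i = fderiv ℝ θs ρ (Pi.single (i : Fin n) 1) (j : Fin n))
    (hD : ∀ (j : {j // j ∈ J}) (i : {i // i ∉ J}),
      D j i = fderiv ℝ η (θs ρ) (Pi.single (i : Fin n) 1) (j : Fin n))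
    (hAinv : IsUnit A) :
    B = A⁻¹ ∧
    C = A⁻¹ * (-D) ∧
    (∀ i ∉ J, ∀ j ∈ J, fderiv ℝ θs ρ (Pi.single j 1) i = 0) ∧
    (∀ i ∉ J, ∀ j ∉ J, fderiv ℝ θs ρ (Pi.single j 1) i = if i = j then 1 else 0) := by
  have hid : ∀ v, ∀ i ∉ J, fderiv ℝ θs ρ v i = v i := fun v i hi =>
    hθs.hasFDerivAt.apply_eq_of_forall_apply_eq (fun y => hout y i hi) v
  have hchain : ∀ v, ∀ j : {j // j ∈ J},
      ∑ k : {k // k ∈ J}, A j k * fderiv ℝ θs ρ v k + ∑ i : {i // i ∉ J}, D j i * v i = v j := by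
    intro v j
    have h := (hη.hasFDerivAt.comp ρ hθs.hasFDerivAt).apply_eq_of_forall_apply_eq
      (fun y => hin y j j.2) v
    rw [ContinuousLinearMap.comp_apply,
      ContinuousLinearMap.pi_apply_eq_sum_subtype_add_sum_subtype J] at h
    simpa only [hA, hD, fun i : {i // i ∉ J} => hid v i i.2] using h
  have hdet : IsUnit A.det := (Matrix.isUnit_iff_isUnit_det A).1 hAinv
  have hAB : A * B = 1 := by
    ext j k
    have h := hchain (Pi.single (k : Fin n) 1) j
    have hzero : ∀ i : {i // i ∉ J}, (Pi.single (k : Fin n) 1 : Fin n → ℝ) i = 0 := fun i =>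
      Pi.single_eq_of_ne (ne_of_mem_of_not_mem k.2 i.2).symm 1
    simp only [hzero, mul_zero, Finset.sum_const_zero, add_zero, ← hB] at h
    rw [Matrix.mul_apply, h, Pi.single_apply, Matrix.one_apply]
    simp only [Subtype.ext_iff]
  have hAC : A * C = -D := by
    ext j i
    have h := hchain (Pi.single (i : Fin n) 1) j
    have hzero : (Pi.single (i : Fin n) 1 : Fin n → ℝ) j = 0 :=
      Pi.single_eq_of_ne (ne_of_mem_of_not_mem j.2 i.2) 1
    simp only [hzero, ← hC, Pi.single_apply, ← Subtype.ext_iff, mul_ite, mul_one, mul_zero,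
      Finset.sum_ite_eq', Finset.mem_univ, if_true] at h
    exact eq_neg_of_add_eq_zero_left h
  refine ⟨(Matrix.inv_eq_right_inv hAB).symm, ?_, fun i hi j hj => ?_, fun i hi j _ => ?_⟩
  · rw [← hAC, Matrix.nonsing_inv_mul_cancel_left A C hdet]
  · rw [hid _ i hi, Pi.single_eq_of_ne (ne_of_mem_of_not_mem hj hi).symm]
  · rw [hid _ i hi, Pi.single_apply]
end

section
/- Fix b < 0. For a ∈ ℝ define I₀(a) = ∫_0^∞ exp(a·y + b·y²) dy and I₁(a) = ∫_0^∞ y·exp(a·y + b·y²) dy. Then the function f(a) = log I₀(a) is differentiable on ℝ, with derivative f'(a) = I₁(a) / I₀(a). -/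
open MeasureTheory

lemma integrable_exp_mul_add_mul_sq {b : ℝ} (hb : b < 0) (a : ℝ) :
    Integrable (fun y : ℝ => Real.exp (a * y + b * y ^ 2)) := by
  have h := (integrable_cexp_quadratic' (b := (b : ℂ)) (by simpa using hb) (a : ℂ) 0).norm
  refine h.congr (Filter.Eventually.of_forall fun y => ?_)
  have hcast : (b : ℂ) * (y : ℂ) ^ 2 + (a : ℂ) * (y : ℂ) + 0
      = ((a * y + b * y ^ 2 : ℝ) : ℂ) := by
    push_cast
    ring
  simp only [hcast, Complex.norm_exp, Complex.ofReal_re]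

lemma hasDerivAt_integral_Ioi_exp_mul_add_mul_sq {b : ℝ} (hb : b < 0) (a : ℝ) :
    HasDerivAt (fun a => ∫ y in Set.Ioi (0 : ℝ), Real.exp (a * y + b * y ^ 2))
      (∫ y in Set.Ioi (0 : ℝ), y * Real.exp (a * y + b * y ^ 2)) a := by
  refine (hasDerivAt_integral_of_dominated_loc_of_deriv_le (𝕜 := ℝ)
    (μ := volume.restrict (Set.Ioi (0 : ℝ)))
    (F := fun x y => Real.exp (x * y + b * y ^ 2))
    (bound := fun y => Real.exp ((a + 2) * y + b * y ^ 2))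
    (F' := fun x y => y * Real.exp (x * y + b * y ^ 2))
    (Iio_mem_nhds (lt_add_one a)) ?_ (integrable_exp_mul_add_mul_sq hb a).integrableOn ?_ ?_
    (integrable_exp_mul_add_mul_sq hb (a + 2)).integrableOn ?_).2
  · exact Filter.Eventually.of_forall fun x =>
      Continuous.aestronglyMeasurable (by fun_prop)
  · exact Continuous.aestronglyMeasurable (by fun_prop)
  · filter_upwards [ae_restrict_mem measurableSet_Ioi] with y (hy : 0 < y) x (hx : x < a + 1)
    rw [Real.norm_of_nonneg (by positivity)]
    calc y * Real.exp (x * y + b * y ^ 2)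
        ≤ Real.exp y * Real.exp ((a + 1) * y + b * y ^ 2) := by
          gcongr
          linarith [Real.add_one_le_exp y]
      _ = Real.exp ((a + 2) * y + b * y ^ 2) := by
          rw [← Real.exp_add]
          ring_nf
  · refine Filter.Eventually.of_forall fun y x _ => ?_
    have h := (((hasDerivAt_id x).mul_const y).add_const (b * y ^ 2)).exp
    simpa [mul_comm] using h

lemma integral_Ioi_exp_mul_add_mul_sq_pos {b : ℝ} (hb : b < 0) (a : ℝ) :
    0 < ∫ y in Set.Ioi (0 : ℝ), Real.exp (a * y + b * y ^ 2) := by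
  have : NeZero (volume.restrict (Set.Ioi (0 : ℝ))) := ⟨by simp⟩
  exact integral_exp_pos (integrable_exp_mul_add_mul_sq hb a).integrableOn

/-- The truncated-normal log-normalizer `f(a) = log ∫₀^∞ exp(ay + by²) dy` (with `b < 0`)
is differentiable in `a`, with derivative the first moment ratio `I₁(a)/I₀(a)`. -/
theorem hasDerivAt_log_truncated_normal_normalizer
    (b : ℝ) (hb : b < 0)
    (I₀ I₁ : ℝ → ℝ)
    (hI₀ : ∀ a : ℝ, I₀ a = ∫ y in Set.Ioi (0 : ℝ), Real.exp (a * y + b * y ^ 2))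
    (hI₁ : ∀ a : ℝ, I₁ a = ∫ y in Set.Ioi (0 : ℝ), y * Real.exp (a * y + b * y ^ 2)) :
    ∀ a : ℝ, HasDerivAt (fun a => Real.log (I₀ a)) (I₁ a / I₀ a) a := by
  intro a
  obtain rfl := funext hI₀
  rw [hI₁]
  exact (hasDerivAt_integral_Ioi_exp_mul_add_mul_sq hb a).log
    (integral_Ioi_exp_mul_add_mul_sq_pos hb a).ne'
end
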